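/- (Romanovski polynomials.) Let b < 0 and b + c > 0, and let m be a nonnegative integer with m < −b. Define the polynomial p_m(x) := ∑_{k=0}^{m} ((−m)_k (2b+m)_k / ((b+c)_k k!)) (−x)^k, where (α)_k = α(α+1)⋯(α+k−1). Then: (a) ∫₀^∞ p_m(x)² x^{b+c−1}(1+x)^{b−c} dx < ∞ (i.e. p_m lies in L² of the weight x^{b+c−1}(1+x)^{b−c} on (0,∞)); and (b) for every x > 0, x(x+1) p_m''(x) + ((b+c)+(2b+1)x) p_m'(x) + b² p_m(x) = (b+m)² p_m(x). -/

import Mathlib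

open MeasureTheory Real Set

noncomputable section

/-- The `m`-th Romanovski polynomial
`p_m(x) = ₂F₁(-m, 2b+m; b+c; -x)
        = ∑_{k=0}^m ((-m)_k (2b+m)_k / ((b+c)_k k!)) (-x)^k`. -/
def romanovski (b c : ℝ) (m : ℕ) (x : ℝ) : ℝ :=
  ∑ k ∈ Finset.range (m + 1),
    (ascPochhammer ℝ k).eval (-(m : ℝ)) * (ascPochhammer ℝ k).eval (2 * b + m) /
      ((ascPochhammer ℝ k).eval (b + c) * (k.factorial : ℝ)) * (-x) ^ k

open Polynomial in
/-- The Romanovski polynomial as an element of `ℝ[X]`. -/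
def romanovskiPoly (b c : ℝ) (m : ℕ) : ℝ[X] :=
  ∑ k ∈ Finset.range (m + 1), monomial k
    ((-1) ^ k * ((ascPochhammer ℝ k).eval (-(m : ℝ)) * (ascPochhammer ℝ k).eval (2 * b + m) /
      ((ascPochhammer ℝ k).eval (b + c) * (k.factorial : ℝ))))

theorem eval_romanovskiPoly (b c : ℝ) (m : ℕ) (x : ℝ) :
    (romanovskiPoly b c m).eval x = romanovski b c m x := by
  simp only [romanovskiPoly, romanovski, Polynomial.eval_finsetSum, Polynomial.eval_monomial]
  refine Finset.sum_congr rfl fun k _ => ?_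
  rw [neg_pow x]
  ring

theorem romanovski_eq_eval (b c : ℝ) (m : ℕ) :
    romanovski b c m = fun x => (romanovskiPoly b c m).eval x :=
  funext fun x => (eval_romanovskiPoly b c m x).symm

theorem degree_romanovskiPoly_le (b c : ℝ) (m : ℕ) : (romanovskiPoly b c m).degree ≤ m := by
  refine (Polynomial.degree_sum_le _ _).trans (Finset.sup_le fun k hk => ?_)
  refine (Polynomial.degree_monomial_le _ _).trans ?_
  exact_mod_cast Nat.lt_succ_iff.mp (Finset.mem_range.mp hk)

theorem coeff_romanovskiPoly (b c : ℝ) (m k : ℕ) :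
    (romanovskiPoly b c m).coeff k =
      (-1) ^ k * ((ascPochhammer ℝ k).eval (-(m : ℝ)) * (ascPochhammer ℝ k).eval (2 * b + m) /
        ((ascPochhammer ℝ k).eval (b + c) * (k.factorial : ℝ))) := by
  simp only [romanovskiPoly, Polynomial.finsetSum_coeff, Polynomial.coeff_monomial,
    Finset.sum_ite_eq', Finset.mem_range]
  split_ifs with h
  · rfl
  · rw [ascPochhammer_eval_neg_coe_nat_of_lt (by omega)]
    simp

theorem coeff_romanovskiPoly_succ {b c : ℝ} (hbc : 0 < b + c) (m k : ℕ) :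
    (k + 1) * (b + c + k) * (romanovskiPoly b c m).coeff (k + 1) =
      (m - k) * (2 * b + m + k) * (romanovskiPoly b c m).coeff k := by
  have hp := (ascPochhammer_pos k _ hbc).ne'
  have hk : b + c + k ≠ 0 := by positivity
  have hf : (k.factorial : ℝ) ≠ 0 := by positivity
  have hs : (k : ℝ) + 1 ≠ 0 := by positivity
  simp only [coeff_romanovskiPoly, ascPochhammer_succ_eval, Nat.factorial_succ, Nat.cast_mul,
    Nat.cast_succ]
  field_simp
  ring

open Polynomial in
/-- The hypergeometric differential equation, as an identity of polynomials. -/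
theorem romanovskiPoly_ode {b c : ℝ} (hbc : 0 < b + c) (m : ℕ) :
    X * (X * derivative (derivative (romanovskiPoly b c m))) +
        X * derivative (derivative (romanovskiPoly b c m)) +
        (C (b + c) * derivative (romanovskiPoly b c m) +
          C (2 * b + 1) * (X * derivative (romanovskiPoly b c m))) =
      C (m * (2 * b + m)) * romanovskiPoly b c m := by
  ext k
  have h := coeff_romanovskiPoly_succ hbc m k
  rcases k with _ | _ | k <;>
    simp only [coeff_add, coeff_C_mul, coeff_X_mul, coeff_X_mul_zero,
      coeff_derivative] <;> push_cast at h ⊢ <;> linear_combination h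

open Asymptotics Filter Topology in
/-- `x ^ (s - 1) * (1 + x) ^ t` times a squared polynomial of degree at most `m` is integrable on
the half-line when `0 < s` and `2 * m + s + t < 0`. -/
theorem integrableOn_sq_eval_mul_rpow (p : Polynomial ℝ) {m : ℕ} (hp : p.degree ≤ m) {s t : ℝ}
    (hs : 0 < s) (hst : 2 * m + s + t < 0) :
    IntegrableOn (fun x : ℝ => p.eval x ^ 2 * (x ^ (s - 1) * (1 + x) ^ t)) (Ioi 0) := by
  have hcont : ContinuousOn (fun x : ℝ => p.eval x ^ 2 * (1 + x) ^ t) (Ici 0) := by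
    refine (p.continuous.pow 2).continuousOn.mul (ContinuousOn.rpow_const (by fun_prop) ?_)
    intro x hx
    have : (0 : ℝ) ≤ x := hx
    left
    positivity
  have hpoly : (fun x => p.eval x) =O[atTop] fun x : ℝ => x ^ m := by
    have := p.isBigO_atTop_of_degree_le (Polynomial.X ^ m) (by simpa using hp)
    simpa using this
  have hlin : (fun x : ℝ => 1 + x) =Θ[atTop] fun x => x := by
    refine IsEquivalent.isTheta ?_
    have h : (fun _ : ℝ => (1 : ℝ)) =o[atTop] fun x : ℝ => x := isLittleO_const_id_atTop 1
    exact h.add_isEquivalent IsEquivalent.refl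
  have hrpow : (fun x : ℝ => (1 + x) ^ t) =O[atTop] fun x => x ^ t :=
    (hlin.rpow ((eventually_ge_atTop 0).mono fun x hx => by
      simp only [Pi.zero_apply]; positivity) (eventually_ge_atTop 0)).1
  have htop : (fun x : ℝ => p.eval x ^ 2 * (1 + x) ^ t) =O[atTop]
      fun x => x ^ (-(-(2 * m + t))) := by
    refine ((hpoly.pow 2).mul hrpow).trans_eventuallyEq ?_
    filter_upwards [eventually_gt_atTop 0] with x hx
    rw [neg_neg, rpow_add hx, ← pow_mul, ← rpow_natCast]
    push_cast
    ring_nf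
  have hbot : (fun x : ℝ => p.eval x ^ 2 * (1 + x) ^ t) =O[𝓝[>] 0]
      fun x => x ^ (-(0 : ℝ)) := by
    simp only [neg_zero, rpow_zero]
    exact ((hcont 0 self_mem_Ici).mono Ioi_subset_Ici_self).isBigO_one ℝ
  refine (mellin_convergent_of_isBigO_scalar
    ((hcont.mono Ioi_subset_Ici_self).locallyIntegrableOn measurableSet_Ioi)
    htop (by linarith) hbot hs).congr_fun (fun x _ => ?_) measurableSet_Ioi
  ring

/-- **Romanovski polynomials:** for `b < 0 < b + c` and `m < -b`,
(a) `p_m` is square-integrable for the weight `x^(b+c-1)(1+x)^(b-c)` on `(0,∞)`, and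
(b) `x(x+1) p_m'' + ((b+c)+(2b+1)x) p_m' + b² p_m = (b+m)² p_m` on `(0,∞)`. -/
theorem romanovski_memL2_and_eigen (b c : ℝ) (hb : b < 0) (hbc : 0 < b + c)
    (m : ℕ) (hm : (m : ℝ) < -b) :
    IntegrableOn
      (fun x : ℝ => (romanovski b c m x) ^ 2 * (x ^ (b + c - 1) * (1 + x) ^ (b - c)))
      (Ioi (0 : ℝ)) ∧
    ∀ x : ℝ, 0 < x →
      x * (x + 1) * deriv (deriv (romanovski b c m)) x +
          ((b + c) + (2 * b + 1) * x) * deriv (romanovski b c m) x +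
          b ^ 2 * romanovski b c m x
        = (b + m) ^ 2 * romanovski b c m x := by
  refine ⟨?_, fun x _ => ?_⟩
  · simp only [← eval_romanovskiPoly]
    exact integrableOn_sq_eval_mul_rpow _ (degree_romanovskiPoly_le b c m) hbc (by linarith)
  · have hderiv : deriv (romanovski b c m) =
        fun x => (Polynomial.derivative (romanovskiPoly b c m)).eval x := by
      ext y
      rw [romanovski_eq_eval, Polynomial.deriv]
    have hode := congrArg (Polynomial.eval x) (romanovskiPoly_ode hbc m)
    simp only [Polynomial.eval_add, Polynomial.eval_mul, Polynomial.eval_X,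
      Polynomial.eval_C] at hode
    rw [hderiv, Polynomial.deriv, ← eval_romanovskiPoly]
    linear_combination hode

end
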